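/- Let m ≥ 1 and define f : ℝ × 𝔹 → ℂ^{m+1}, where 𝔹 ⊂ ℂ^m is the open unit ball, by f(s,z) = (e^{2is}·z, e^{2is}·√(1−‖z‖²)). Let α₀ be the 1-form on ℂ^{m+1} whose value at w is the linear functional α₀_w(u) = (1/2)·Σ_{i=1}^{m+1} Im(conj(w_i)·u_i), and let λ be the 1-form on ℂ^m with λ_z(v) = (1/2)·Σ_{i=1}^{m} Im(conj(z_i)·v_i). Then f pulls back α₀ to ds + λ: for every (s,z) ∈ ℝ × 𝔹 and every (a,v) ∈ ℝ × ℂ^m, α₀_{f(s,z)}(Df(s,z)(a,v)) = a + λ_z(v). -/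

import Mathlib

open Metric MeasureTheory

noncomputable section

/-- `ℂ^m` with the Euclidean (ℓ²) norm, identified with `ℝ^{2m}`. -/
abbrev E (m : ℕ) := EuclideanSpace ℂ (Fin m)

/-- The standard primitive `λ_z(v) = (1/2) Σᵢ Im(conj zᵢ · vᵢ)` (of the standard
symplectic form on `ℂ^k`); on the unit sphere of `ℂ^{m+1}` it restricts to the
standard contact form `α₀`. -/
def stdLam {k : ℕ} (z v : E k) : ℝ := (1 / 2) * ∑ i, ((starRingEnd ℂ) (z i) * v i).im

/-- The derivative of `(s, z) ↦ e^{2is} g(z)`. -/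
lemma hasFDerivAt_exp_mul {V : Type*} [NormedAddCommGroup V] [NormedSpace ℝ V]
    {g : V → ℂ} {g' : V →L[ℝ] ℂ} {z : V} (hg : HasFDerivAt g g' z) (s : ℝ) :
    ∃ L : ℝ × V →L[ℝ] ℂ,
      HasFDerivAt (fun p : ℝ × V => Complex.exp (2 * p.1 * Complex.I) * g p.2) L (s, z) ∧
      ∀ a v, L (a, v) =
        Complex.exp (2 * s * Complex.I) * (2 * a * Complex.I * g z + g' v) := by
  have he : HasFDerivAt (fun p : ℝ × V => Complex.exp (2 * (p.1 : ℂ) * Complex.I)) _ (s, z) :=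
    (((Complex.ofRealCLM.hasFDerivAt.comp (s, z) (hasFDerivAt_fst (𝕜 := ℝ))).const_mul
      (2 : ℂ)).mul_const Complex.I).cexp
  refine ⟨_, he.mul (HasFDerivAt.comp (s, z) hg hasFDerivAt_snd), fun a v => ?_⟩
  simp
  ring

/-- Rotating by a phase contributes the angular term `2a|w|²`. -/
lemma im_conj_exp_mul (s a : ℝ) (w d : ℂ) :
    ((starRingEnd ℂ) (Complex.exp (2 * s * Complex.I) * w) *
      (Complex.exp (2 * s * Complex.I) * (2 * a * Complex.I * w + d))).im =
      2 * a * ‖w‖ ^ 2 + ((starRingEnd ℂ) w * d).im := by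
  have he : (starRingEnd ℂ) (Complex.exp (2 * s * Complex.I)) *
      Complex.exp (2 * s * Complex.I) = 1 := by
    rw [← Complex.exp_conj, ← Complex.exp_add, map_mul, map_mul, map_ofNat]
    simp
  have : (starRingEnd ℂ) (Complex.exp (2 * s * Complex.I) * w) *
      (Complex.exp (2 * s * Complex.I) * (2 * a * Complex.I * w + d)) =
      (starRingEnd ℂ) w * (2 * a * Complex.I * w + d) := by
    rw [map_mul]
    linear_combination (starRingEnd ℂ) w * (2 * a * Complex.I * w + d) * he
  rw [this, ← Complex.normSq_eq_norm_sq, Complex.normSq_apply]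
  simp
  ring

/-- the trivialization `f(s,z) = (e^{2is}·z, e^{2is}·√(1−‖z‖²))` of the
complement of a codimension-two sphere in `S^{2m+1}` pulls back the standard contact
form `α₀` to `ds + λ`: `α₀_{f(s,z)}(Df(s,z)(a,v)) = a + λ_z(v)`. -/
theorem pullback_of_standard_contact_form (m : ℕ) (hm : 1 ≤ m)
    (f : ℝ × E m → E (m + 1))
    (hf : ∀ (s : ℝ) (z : E m) (i : Fin (m + 1)),
      f (s, z) i = if h : (i : ℕ) < m
        then Complex.exp (2 * s * Complex.I) * z ⟨i, h⟩
        else Complex.exp (2 * s * Complex.I) * Complex.ofReal (Real.sqrt (1 - ‖z‖ ^ 2))) :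
    ∀ (s : ℝ), ∀ z ∈ ball (0 : E m) 1, ∀ (a : ℝ) (v : E m),
      stdLam (f (s, z)) (fderiv ℝ f (s, z) (a, v)) = a + stdLam z v := by
  intro s z hz a v
  have hz1 : 0 < 1 - ‖z‖ ^ 2 := by
    have := mem_ball_zero_iff.mp hz
    nlinarith [norm_nonneg z]
  have hr : DifferentiableAt ℝ (fun y : E m => Real.sqrt (1 - ‖y‖ ^ 2)) z :=
    (((contDiff_norm_sq ℂ (n := 1)).differentiable one_ne_zero z).const_sub 1).sqrt hz1.ne'
  obtain ⟨r', hr'⟩ := hr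
  have hlast : HasFDerivAt (fun y : E m => ((Real.sqrt (1 - ‖y‖ ^ 2) : ℝ) : ℂ))
      (Complex.ofRealCLM.comp r') z := Complex.ofRealCLM.hasFDerivAt.comp z hr'
  have hcoord (j : Fin m) : HasFDerivAt (fun y : E m => y j)
      ((EuclideanSpace.proj j : E m →L[ℂ] ℂ).restrictScalars ℝ) z :=
    ((EuclideanSpace.proj j : E m →L[ℂ] ℂ).restrictScalars ℝ).hasFDerivAt
  choose L hL hLv using fun j => hasFDerivAt_exp_mul (hcoord j) s
  obtain ⟨K, hK, hKv⟩ := hasFDerivAt_exp_mul hlast s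
  have hf_castSucc (j : Fin m) : (fun p : ℝ × E m => f p j.castSucc) =
      fun p => Complex.exp (2 * p.1 * Complex.I) * p.2 j := by
    ext p
    simpa using hf p.1 p.2 j.castSucc
  have hf_last : (fun p : ℝ × E m => f p (Fin.last m)) =
      fun p => Complex.exp (2 * p.1 * Complex.I) * ((Real.sqrt (1 - ‖p.2‖ ^ 2) : ℝ) : ℂ) := by
    ext p
    simpa using hf p.1 p.2 (Fin.last m)
  have hdiff : DifferentiableAt ℝ f (s, z) := by
    rw [differentiableAt_piLp 2]
    intro i
    induction i using Fin.lastCases with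
    | last => rw [hf_last]; exact hK.differentiableAt
    | cast j => rw [hf_castSucc]; exact (hL j).differentiableAt
  have happly (i : Fin (m + 1)) : HasFDerivAt (fun p => f p i)
      (((EuclideanSpace.proj i : E (m + 1) →L[ℂ] ℂ).restrictScalars ℝ).comp
        (fderiv ℝ f (s, z))) (s, z) :=
    ((EuclideanSpace.proj i : E (m + 1) →L[ℂ] ℂ).restrictScalars ℝ).hasFDerivAt.comp (s, z)
      hdiff.hasFDerivAt
  have hD_castSucc (j : Fin m) : fderiv ℝ f (s, z) (a, v) j.castSucc = L j (a, v) :=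
    DFunLike.congr_fun ((happly j.castSucc).unique (hf_castSucc j ▸ hL j)) (a, v)
  have hD_last : fderiv ℝ f (s, z) (a, v) (Fin.last m) = K (a, v) :=
    DFunLike.congr_fun ((happly (Fin.last m)).unique (hf_last ▸ hK)) (a, v)
  have hsq : ‖z‖ ^ 2 = ∑ j, ‖z j‖ ^ 2 := EuclideanSpace.norm_sq_eq z
  have hterm_castSucc (j : Fin m) : ((starRingEnd ℂ) (f (s, z) j.castSucc) *
      fderiv ℝ f (s, z) (a, v) j.castSucc).im =
      2 * a * ‖z j‖ ^ 2 + ((starRingEnd ℂ) (z j) * v j).im := by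
    rw [hD_castSucc, hLv, congrFun (hf_castSucc j) (s, z), im_conj_exp_mul]
    rfl
  have hterm_last : ((starRingEnd ℂ) (f (s, z) (Fin.last m)) *
      fderiv ℝ f (s, z) (a, v) (Fin.last m)).im = 2 * a * (1 - ‖z‖ ^ 2) := by
    rw [hD_last, hKv, congrFun hf_last (s, z), im_conj_exp_mul, Complex.norm_real,
      Real.norm_eq_abs, sq_abs, Real.sq_sqrt hz1.le]
    simp
  simp only [stdLam]
  rw [Fin.sum_univ_castSucc, hterm_last, Finset.sum_congr rfl fun j _ => hterm_castSucc j,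
    Finset.sum_add_distrib, ← Finset.mul_sum, ← hsq]
  ring
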